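/- For n = 3 (N = {1,2,3}), there is no mechanism that is both CE-efficient and respects improvement: every CE-efficient mechanism violates respecting improvement. -/

import Mathlib

/-- Each division has a strict linear (total) preference order over workers. -/
def StrictProfile {α : Type*} (pref : α → α → α → Prop) : Prop :=
  ∀ i, IsStrictTotalOrder α (pref i)

/-- `pref'` is an improvement for division `i` with respect to `pref`. -/
def Improvement {α : Type*} (pref pref' : α → α → α → Prop) (i : α) : Prop :=
  pref' i = pref i ∧
  (∀ j, j ≠ i → ∀ k, k ≠ i → pref j i k → pref' j i k) ∧
  (∀ j, j ≠ i → ∀ k, k ≠ i → ∀ l, l ≠ i → (pref j k l ↔ pref' j k l))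

/-- The assignment `μ` is a derangement that is CE-efficient at `pref`: `μ` has no
fixed point, and no derangement `μ'` weakly improves every division and strictly
improves some division. -/
def CEEfficientAt {α : Type*} (pref : α → α → α → Prop) (μ : Equiv.Perm α) : Prop :=
  (∀ i, μ i ≠ i) ∧
  ¬ ∃ μ' : Equiv.Perm α, (∀ i, μ' i ≠ i) ∧
      (∀ i, μ' i = μ i ∨ pref i (μ' i) (μ i)) ∧ (∃ j, pref j (μ' j) (μ j))

/-- Rank of worker `k` in the eyes of division `j`: own worker last; `true` means that
`j + 1` comes before `j + 2`, `false` the reverse. -/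
def rkAux (b : Bool) (j k : Fin 3) : ℕ :=
  if k = j then 2 else if k = j + 1 then (if b then 0 else 1) else (if b then 1 else 0)

/-- The profile given by three types. -/
def profAux (t : Fin 3 → Bool) (j k l : Fin 3) : Prop := rkAux (t j) j k < rkAux (t j) j l

instance (t : Fin 3 → Bool) (j k l : Fin 3) : Decidable (profAux t j k l) := by
  unfold profAux; infer_instance

theorem rkAux_inj : ∀ (b : Bool) (j k l : Fin 3), rkAux b j k = rkAux b j l → k = l := by
  decide

theorem profAux_strict (t : Fin 3 → Bool) : StrictProfile (profAux t) := fun i =>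
  { trichotomous := fun a b h1 h2 =>
      rkAux_inj (t i) i a b (le_antisymm (not_lt.mp h2) (not_lt.mp h1))
    irrefl := fun a => lt_irrefl (rkAux (t i) i a)
    trans := fun _ _ _ h1 h2 => lt_trans (α := ℕ) h1 h2 }

theorem improvementAux (t t' : Fin 3 → Bool) (i : Fin 3) (h0 : t' i = t i)
    (h : (∀ j, j ≠ i → ∀ k, k ≠ i → profAux t j i k → profAux t' j i k) ∧
      (∀ j, j ≠ i → ∀ k, k ≠ i → ∀ l, l ≠ i → (profAux t j k l ↔ profAux t' j k l))) :
    Improvement (profAux t) (profAux t') i :=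
  ⟨by funext k l; simp [profAux, h0], h⟩

/-- The only derangements of three points are the two rotations. -/
theorem derangeAux : ∀ μ : Equiv.Perm (Fin 3), (∀ i, μ i ≠ i) →
    μ = finRotate 3 ∨ μ = (finRotate 3)⁻¹ := by
  decide

/-- For `n = 3`, no mechanism is both CE-efficient and respects improvement:
every CE-efficient mechanism violates respecting improvement. -/
theorem n3_no_CEE_and_RI :
    ¬ ∃ f : (Fin 3 → Fin 3 → Fin 3 → Prop) → Equiv.Perm (Fin 3),
      (∀ pref, StrictProfile pref → CEEfficientAt pref (f pref)) ∧
      (∀ pref pref' (i : Fin 3), StrictProfile pref → StrictProfile pref' →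
        Improvement pref pref' i →
        (f pref' i = f pref i ∨ pref i (f pref' i) (f pref i))) := by
  rintro ⟨f, hE, hR⟩
  have d : ∀ t, f (profAux t) = finRotate 3 ∨ f (profAux t) = (finRotate 3)⁻¹ :=
    fun t => derangeAux _ (hE _ (profAux_strict t)).1
  have eA : f (profAux ![true, true, true]) = finRotate 3 := by
    rcases d ![true, true, true] with h | h
    · exact h
    · have h2 := (hE _ (profAux_strict ![true, true, true])).2
      rw [h] at h2
      exact absurd ⟨finRotate 3, by decide, by decide, by decide⟩ h2
  have eB : f (profAux ![false, false, false]) = (finRotate 3)⁻¹ := by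
    rcases d ![false, false, false] with h | h
    · have h2 := (hE _ (profAux_strict ![false, false, false])).2
      rw [h] at h2
      exact absurd ⟨(finRotate 3)⁻¹, by decide, by decide, by decide⟩ h2
    · exact h
  have r1 := hR _ _ 0 (profAux_strict ![true, true, true]) (profAux_strict ![true, false, true])
    (improvementAux _ _ _ (by decide) (by decide))
  have r2 := hR _ _ 2 (profAux_strict ![true, false, true]) (profAux_strict ![false, false, true])
    (improvementAux _ _ _ (by decide) (by decide))
  have r3 := hR _ _ 0 (profAux_strict ![false, false, false])
    (profAux_strict ![false, false, true])
    (improvementAux _ _ _ (by decide) (by decide))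
  rw [eA] at r1
  rw [eB] at r3
  rcases d ![true, false, true] with h1 | h1 <;> rcases d ![false, false, true] with h2 | h2 <;>
    rw [h1] at r1 r2 <;> rw [h2] at r2 r3 <;> revert r1 r2 r3 <;> decide
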